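/- arXiv:1205.4788 — 6 statements merged into one kernel-verified Lean document; each statement's English description precedes it below -/
import Mathlib

section
/- Let b, A, ε, v, x, m, t : ℝ with b > 0, A ≥ 0, ε > 0, v ≥ 0, 0 ≤ t ≤ ε, and 2*b*(m - x) ≥ v^2 + (A + b)*(A*ε^2 + 2*ε*v). Then (v + A*t)^2 ≤ 2*b*(m - (x + v*t + (A/2)*t^2)). -/
/-- The acceleration guard χ of the time-triggered controller preserves the
braking invariant after accelerating for any time t ≤ ε. -/
theorem accel_guard_preserves_invariant (b A ε v x m t : ℝ)
    (hb : b > 0) (hA : A ≥ 0) (hε : ε > 0) (hv : v ≥ 0)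
    (ht0 : 0 ≤ t) (htε : t ≤ ε)
    (hguard : 2 * b * (m - x) ≥ v ^ 2 + (A + b) * (A * ε ^ 2 + 2 * ε * v)) :
    (v + A * t) ^ 2 ≤ 2 * b * (m - (x + v * t + (A / 2) * t ^ 2)) := by
  have key : (A + b) * (A * t ^ 2 + 2 * t * v) ≤ (A + b) * (A * ε ^ 2 + 2 * ε * v) := by
    gcongr
  linarith
end

section
/- Let b, A, ε, m : ℝ with b > 0, A ≥ 0, ε > 0. Define a step relation on ℝ × ℝ: (x, v) steps to (x', v') iff there exist a, t : ℝ with t ≥ 0, t ≤ ε, such that either a = -b, or (a = A and 2*b*(m - x) ≥ v^2 + (A + b)*(A*ε^2 + 2*ε*v)), and v + a*s ≥ 0 for all s ∈ [0, t], and x' = x + v*t + (a/2)*t^2 and v' = v + a*t. If v₀ ≥ 0 and v₀^2 ≤ 2*b*(m - x₀), then every state (x, v) in the reflexive transitive closure of this step relation starting from (x₀, v₀) satisfies x ≤ m. -/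
/-- Semantic content of the dL safety theorem
v² ≤ 2b(m - x) ∧ A ≥ 0 ∧ b > 0 → [car_ε] x ≤ m. -/
theorem car_eps_safe (b A ε m : ℝ) (hb : b > 0) (hA : A ≥ 0) (hε : ε > 0)
    (x₀ v₀ : ℝ) (hv₀ : v₀ ≥ 0) (hinv : v₀ ^ 2 ≤ 2 * b * (m - x₀)) :
    ∀ p : ℝ × ℝ,
      Relation.ReflTransGen
        (fun s s' : ℝ × ℝ => ∃ a t : ℝ, t ≥ 0 ∧ t ≤ ε ∧
          (a = -b ∨ (a = A ∧
            2 * b * (m - s.1) ≥ s.2 ^ 2 + (A + b) * (A * ε ^ 2 + 2 * ε * s.2))) ∧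
          (∀ u : ℝ, u ∈ Set.Icc 0 t → s.2 + a * u ≥ 0) ∧
          s'.1 = s.1 + s.2 * t + (a / 2) * t ^ 2 ∧ s'.2 = s.2 + a * t)
        (x₀, v₀) p →
      p.1 ≤ m := by
  intro p hp
  suffices h : 0 ≤ p.2 ∧ p.2 ^ 2 ≤ 2 * b * (m - p.1) by
    have hnn : 0 ≤ 2 * b * (m - p.1) := (sq_nonneg p.2).trans h.2
    linarith [nonneg_of_mul_nonneg_right hnn (by positivity : 0 < 2 * b)]
  induction hp with
  | refl => exact ⟨hv₀, hinv⟩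
  | @tail s s' _ hstep ih =>
    obtain ⟨hv, hbrake⟩ := ih
    obtain ⟨a, t, ht, htε, hctrl, hdom, hx', hv'⟩ := hstep
    rw [hx', hv']
    refine ⟨hdom t ⟨ht, le_rfl⟩, ?_⟩
    rcases hctrl with rfl | ⟨rfl, hguard⟩
    · linarith
    · have hdist : a * t ^ 2 + 2 * t * s.2 ≤ a * ε ^ 2 + 2 * ε * s.2 := by gcongr
      have hmul := mul_le_mul_of_nonneg_left hdist (by positivity : 0 ≤ a + b)
      linarith
end

section
/- (Soundness of differential induction for p ≥ 0.) Fix n : ℕ, polynomials θ i ∈ ℝ[x₁,…,xₙ] for i : Fin n, a polynomial p ∈ ℝ[x₁,…,xₙ], and a set χ ⊆ (Fin n → ℝ). Assume that for every x ∈ χ, (∑ i, (pderiv i p) * θ i).eval x ≥ 0. Let r ≥ 0 and let φ : ℝ → (Fin n → ℝ) solve the system on [0, r] with φ t ∈ χ for all t ∈ [0, r]. If p.eval (φ 0) ≥ 0, then p.eval (φ t) ≥ 0 for all t ∈ [0, r]. -/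
open MvPolynomial

/-- The chain rule for a multivariate polynomial along a curve with differentiable coordinates. -/
theorem MvPolynomial.hasDerivAt_eval_comp {𝕜 σ : Type*} [NontriviallyNormedField 𝕜] [Fintype σ]
    (p : MvPolynomial σ 𝕜) {φ : 𝕜 → σ → 𝕜} {φ' : σ → 𝕜} {t : 𝕜}
    (hφ : ∀ i, HasDerivAt (fun s => φ s i) (φ' i) t) :
    HasDerivAt (fun s => p.eval (φ s)) (∑ i, (pderiv i p).eval (φ t) * φ' i) t := by
  classical
  induction p using MvPolynomial.induction_on with
  | C a => simpa using hasDerivAt_const t a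
  | add p q hp hq =>
    simpa [add_mul, Finset.sum_add_distrib] using hp.fun_add hq
  | mul_X p j hp =>
    simp only [map_mul, eval_X]
    refine (hp.fun_mul (hφ j)).congr_deriv ?_
    simp only [Derivation.leibniz, pderiv_X, smul_eq_mul, map_add, map_mul, eval_X, add_mul,
      Finset.sum_add_distrib, Pi.single_apply, apply_ite (eval (φ t)), map_zero,
      mul_ite, ite_mul, mul_one, mul_zero, zero_mul, Finset.sum_ite_eq, Finset.mem_univ, if_true,
      Finset.sum_mul]
    rw [add_comm]
    congr 1
    exact Finset.sum_congr rfl fun i _ => by ring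

/-- Soundness of differential induction (rule DI) for postconditions p ≥ 0. -/
theorem differential_induction_ge (n : ℕ) (θ : Fin n → MvPolynomial (Fin n) ℝ)
    (p : MvPolynomial (Fin n) ℝ) (χ : Set (Fin n → ℝ))
    (hLie : ∀ x ∈ χ, (∑ i, pderiv i p * θ i).eval x ≥ 0)
    (r : ℝ) (hr : r ≥ 0) (φ : ℝ → (Fin n → ℝ))
    (hφ : ∀ i : Fin n, ∀ t ∈ Set.Icc (0 : ℝ) r,
      HasDerivAt (fun s => φ s i) ((θ i).eval (φ t)) t)
    (hχ : ∀ t ∈ Set.Icc (0 : ℝ) r, φ t ∈ χ)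
    (h0 : p.eval (φ 0) ≥ 0) :
    ∀ t ∈ Set.Icc (0 : ℝ) r, p.eval (φ t) ≥ 0 := by
  have hderiv : ∀ t ∈ Set.Icc (0 : ℝ) r, HasDerivAt (fun s => p.eval (φ s))
      ((∑ i, pderiv i p * θ i).eval (φ t)) t := fun t ht => by
    simpa using p.hasDerivAt_eval_comp fun i => hφ i t ht
  have hmono : MonotoneOn (fun s => p.eval (φ s)) (Set.Icc 0 r) := by
    refine monotoneOn_of_deriv_nonneg (convex_Icc 0 r)
      (fun t ht => (hderiv t ht).continuousAt.continuousWithinAt)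
      (fun t ht => (hderiv t (interior_subset ht)).differentiableAt.differentiableWithinAt)
      fun t ht => ?_
    rw [(hderiv t (interior_subset ht)).deriv]
    exact hLie _ (hχ t (interior_subset ht))
  exact fun t ht => h0.le.trans (hmono (Set.left_mem_Icc.2 hr) ht ht.1)
end

section
/- Let a, r : ℝ with a ≥ 0 and r ≥ 0, and let x : ℝ → ℝ be such that for every t ∈ [0, r], x has derivative (x t - 3)^4 + a at t. If (x 0)^3 ≥ -1, then (x t)^3 ≥ -1 for all t ∈ [0, r]. -/
/-- Quartic dynamics x' = (x - 3)⁴ + a with a ≥ 0: x³ ≥ -1 is a differential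
invariant. -/
theorem quartic_invariant (a r : ℝ) (ha : a ≥ 0) (hr : r ≥ 0) (x : ℝ → ℝ)
    (hx : ∀ t ∈ Set.Icc (0 : ℝ) r, HasDerivAt x ((x t - 3) ^ 4 + a) t)
    (h0 : (x 0) ^ 3 ≥ -1) :
    ∀ t ∈ Set.Icc (0 : ℝ) r, (x t) ^ 3 ≥ -1 := by
  have hmono : MonotoneOn x (Set.Icc 0 r) := by
    refine monotoneOn_of_hasDerivWithinAt_nonneg (f' := fun t => (x t - 3) ^ 4 + a)
      (convex_Icc 0 r) (fun t ht => (hx t ht).continuousAt.continuousWithinAt)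
      (fun t ht => (hx t (interior_subset ht)).hasDerivWithinAt) fun t _ => ?_
    positivity
  intro t ht
  have hodd : Odd 3 := by decide
  exact h0.le.trans (hodd.strictMono_pow.monotone (hmono (Set.left_mem_Icc.2 hr) ht ht.1))
end

section
/- Let r : ℝ with r ≥ 0 and let x, y : ℝ → ℝ be such that for every t ∈ [0, r], x has derivative (x t - 3)^4 + (y t)^5 at t and y has derivative (y t)^2 at t. If (x 0)^3 ≥ -1 and (y 0)^5 ≥ 0, then (x t)^3 ≥ -1 for all t ∈ [0, r]. -/
theorem monotoneOn_Icc_of_hasDerivAt_nonneg {f f' : ℝ → ℝ} {a b : ℝ}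
    (hf : ∀ t ∈ Set.Icc a b, HasDerivAt f (f' t) t) (hf' : ∀ t ∈ Set.Icc a b, 0 ≤ f' t) :
    MonotoneOn f (Set.Icc a b) :=
  monotoneOn_of_hasDerivWithinAt_nonneg (convex_Icc a b)
    (fun t ht => (hf t ht).continuousAt.continuousWithinAt)
    (fun t ht => (hf t (interior_subset ht)).hasDerivWithinAt)
    (fun t ht => hf' t (interior_subset ht))


/-- Differential cut example: for x' = (x - 3)⁴ + y⁵, y' = y², first y⁵ ≥ 0 is
invariant, and with this cut x³ ≥ -1 is invariant. -/
theorem differential_cut_example (r : ℝ) (hr : r ≥ 0) (x y : ℝ → ℝ)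
    (hx : ∀ t ∈ Set.Icc (0 : ℝ) r,
      HasDerivAt x ((x t - 3) ^ 4 + (y t) ^ 5) t)
    (hy : ∀ t ∈ Set.Icc (0 : ℝ) r, HasDerivAt y ((y t) ^ 2) t)
    (hx0 : (x 0) ^ 3 ≥ -1) (hy0 : (y 0) ^ 5 ≥ 0) :
    ∀ t ∈ Set.Icc (0 : ℝ) r, (x t) ^ 3 ≥ -1 := by
  have h0 : (0 : ℝ) ∈ Set.Icc (0 : ℝ) r := ⟨le_rfl, hr⟩
  have y_mono := monotoneOn_Icc_of_hasDerivAt_nonneg hy fun t _ => sq_nonneg (y t)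
  have y_pow_nonneg : ∀ t ∈ Set.Icc (0 : ℝ) r, 0 ≤ (y t) ^ 5 := fun t ht =>
    hy0.le.trans ((Odd.strictMono_pow (by decide)).monotone (y_mono h0 ht ht.1))
  have x_mono := monotoneOn_Icc_of_hasDerivAt_nonneg hx fun t ht =>
    add_nonneg (Even.pow_nonneg (by decide) _) (y_pow_nonneg t ht)
  intro t ht
  exact hx0.le.trans ((Odd.strictMono_pow (by decide)).monotone (x_mono h0 ht ht.1))
end

section
/- (Progress lemma underlying differential variants.) Let h : ℝ → ℝ be differentiable and let ε > 0. Assume that for every t ≥ 0 with h t < 0 one has deriv h t ≥ ε. Then there exists t ≥ 0 with h t ≥ 0. -/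
/-- Progress lemma underlying differential variants (rule DV): minimum progress
rate ε > 0 towards h ≥ 0 attains the goal in finite time. -/
theorem differential_variant_progress (h : ℝ → ℝ) (hd : Differentiable ℝ h)
    (ε : ℝ) (hε : ε > 0)
    (hprog : ∀ t : ℝ, t ≥ 0 → h t < 0 → deriv h t ≥ ε) :
    ∃ t : ℝ, t ≥ 0 ∧ h t ≥ 0 := by
  by_contra! hneg
  have hT : 0 ≤ -h 0 / ε := div_nonneg (neg_nonneg.2 (hneg 0 le_rfl).le) hε.le
  have hmv := (convex_Ici (0 : ℝ)).mul_sub_le_image_sub_of_le_deriv hd.continuous.continuousOn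
    hd.differentiableOn
    (fun t ht => hprog t (interior_subset ht) (hneg t (interior_subset ht)))
    0 Set.self_mem_Ici (-h 0 / ε) hT hT
  rw [sub_zero, mul_div_cancel₀ _ hε.ne'] at hmv
  linarith [hneg _ hT]
end
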